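/- arXiv:1305.7407 — 3 statements merged into one kernel-verified Lean document; each statement's English description precedes it below -/
import Mathlib

section
/- Suppose ψ is an electrostatic potential for u (with parameter ε > 0). Then for every (x,z) in the closure of Ω(u) one has 1 + z ≤ ψ(x,z) ≤ 1. -/
open MeasureTheory Set

/-- The region `Ω(u)` between the ground plate `z = -1` and the membrane `z = u(x)`. -/
def Omega (u : ℝ → ℝ) : Set (ℝ × ℝ) :=
  {p : ℝ × ℝ | -1 < p.1 ∧ p.1 < 1 ∧ -1 < p.2 ∧ p.2 < u p.1}

/-- Partial derivative of `ψ` with respect to the first (horizontal) variable `x`. -/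
noncomputable def pdx (ψ : ℝ → ℝ → ℝ) (x z : ℝ) : ℝ := deriv (fun x' => ψ x' z) x

/-- Partial derivative of `ψ` with respect to the second (vertical) variable `z`. -/
noncomputable def pdz (ψ : ℝ → ℝ → ℝ) (x z : ℝ) : ℝ := deriv (fun z' => ψ x z') z

/-- Second partial derivative of `ψ` in `x`. -/
noncomputable def pdxx (ψ : ℝ → ℝ → ℝ) (x z : ℝ) : ℝ := deriv (fun x' => pdx ψ x' z) x

/-- Second partial derivative of `ψ` in `z`. -/
noncomputable def pdzz (ψ : ℝ → ℝ → ℝ) (x z : ℝ) : ℝ := deriv (fun z' => pdz ψ x z') z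

/-- Mixed partial derivative `∂ₓ∂_z ψ`. -/
noncomputable def pdxz (ψ : ℝ → ℝ → ℝ) (x z : ℝ) : ℝ := deriv (fun x' => pdz ψ x' z) x

open Filter Topology

theorem IsLocalMax.deriv_deriv_nonpos {f : ℝ → ℝ} {x : ℝ} (h : IsLocalMax f x)
    (hc : ContinuousAt f x) : deriv (deriv f) x ≤ 0 := by
  by_contra! hpos
  have hmin := isLocalMin_of_deriv_deriv_pos hpos h.deriv_eq_zero hc
  have hconst : f =ᶠ[𝓝 x] fun _ => f x := by
    filter_upwards [h, hmin] with y h₁ h₂ using le_antisymm h₁ h₂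
  have := hconst.deriv.deriv_eq
  simp at this
  exact hpos.ne' this

theorem deriv_deriv_const_mul_add_quadratic {f : ℝ → ℝ} {x : ℝ} (hf : ContDiffAt ℝ 2 f x)
    (s a b k : ℝ) :
    deriv (deriv fun t => s * f t + (a * t ^ 2 + b * t + k)) x =
      s * deriv (deriv f) x + 2 * a := by
  have hquad (t : ℝ) : HasDerivAt (fun t : ℝ => a * t ^ 2 + b * t + k) (2 * a * t + b) t := by
    exact ((((hasDerivAt_pow 2 t).const_mul a).add ((hasDerivAt_id t).const_mul b)).add_const
      k).congr_deriv (by norm_num; ring)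
  have hev : deriv (fun t => s * f t + (a * t ^ 2 + b * t + k)) =ᶠ[𝓝 x]
      fun t => s * deriv f t + (2 * a * t + b) := by
    filter_upwards [hf.eventually (by simp)] with t ht
    exact (((ht.differentiableAt (by simp)).hasDerivAt.const_mul s).add (hquad t)).deriv
  have hf' : DifferentiableAt ℝ (deriv f) x := by
    simp only [funext fun y => (fderiv_apply_one_eq_deriv (𝕜 := ℝ) (f := f) (x := y)).symm]
    exact ((hf.fderiv_right (m := 1) le_rfl).differentiableAt (by simp)).clm_apply (by fun_prop)
  rw [hev.deriv_eq]
  have hlin : HasDerivAt (fun t : ℝ => 2 * a * t + b) (2 * a) x := by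
    simpa using ((hasDerivAt_id x).const_mul (2 * a)).add_const b
  exact ((hf'.hasDerivAt.const_mul s).add hlin).deriv

theorem isOpen_Omega {u : ℝ → ℝ} (hu : ContinuousOn u (Icc (-1) 1)) : IsOpen (Omega u) := by
  rw [isOpen_iff_mem_nhds]
  rintro ⟨x, z⟩ ⟨h₁, h₂, h₃, h₄⟩
  have hux : ContinuousAt (fun p : ℝ × ℝ => u p.1) (x, z) :=
    ContinuousAt.comp (f := Prod.fst) (g := u) (hu.continuousAt (Icc_mem_nhds h₁ h₂))
      continuousAt_fst
  filter_upwards [continuousAt_fst.eventually (lt_mem_nhds h₁),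
    continuousAt_fst.eventually (gt_mem_nhds h₂),
    continuousAt_snd.eventually (lt_mem_nhds h₃),
    continuousAt_snd.eventually_lt hux h₄] with p a b c d
  exact ⟨a, b, c, d⟩

theorem closure_Omega_subset {u : ℝ → ℝ} (hu : ContinuousOn u (Icc (-1) 1)) :
    closure (Omega u) ⊆ {p : ℝ × ℝ | p.1 ∈ Icc (-1) 1 ∧ -1 ≤ p.2 ∧ p.2 ≤ u p.1} := by
  have hsub : Omega u ⊆ {p : ℝ × ℝ | p.1 ∈ Icc (-1) 1 ∧ -1 ≤ p.2 ∧ p.2 ≤ u p.1} :=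
    fun p ⟨h₁, h₂, h₃, h₄⟩ => ⟨⟨h₁.le, h₂.le⟩, h₃.le, h₄.le⟩
  refine closure_minimal hsub ?_
  have hS : IsClosed {p : ℝ × ℝ | p.1 ∈ Icc (-1) 1} := isClosed_Icc.preimage continuous_fst
  have h : IsClosed {p : ℝ × ℝ | p ∈ {p : ℝ × ℝ | p.1 ∈ Icc (-1) 1} ∧ p.2 ≤ u p.1} :=
    hS.isClosed_le continuousOn_snd (hu.comp continuousOn_fst fun _ hp => hp)
  have h' : IsClosed {p : ℝ × ℝ | -1 ≤ p.2} := isClosed_le continuous_const continuous_snd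
  convert h.inter h' using 1
  ext p
  simp only [mem_ofPred_eq, mem_inter_iff]
  tauto

/-- The weak maximum principle for `s ψ + b z`, where `ψ` solves the rescaled Laplace equation on a
bounded open set. -/
theorem rescaled_laplace_le_of_frontier_le {ε : ℝ} (hε : 0 < ε) {U : Set (ℝ × ℝ)}
    (hU : IsOpen U) (hUc : IsCompact (closure U)) {ψ : ℝ → ℝ → ℝ}
    (hcont : ContinuousOn (fun p : ℝ × ℝ => ψ p.1 p.2) (closure U))
    (hreg : ContDiffOn ℝ 2 (fun p : ℝ × ℝ => ψ p.1 p.2) U)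
    (hpde : ∀ p ∈ U, ε ^ 2 * pdxx ψ p.1 p.2 + pdzz ψ p.1 p.2 = 0) {s b c : ℝ}
    (hbc : ∀ p ∈ frontier U, s * ψ p.1 p.2 + b * p.2 ≤ c) {p : ℝ × ℝ} (hp : p ∈ closure U) :
    s * ψ p.1 p.2 + b * p.2 ≤ c := by
  obtain ⟨M, hM⟩ : BddAbove ((fun q : ℝ × ℝ => q.1 ^ 2) '' closure U) :=
    (hUc.image (by fun_prop)).bddAbove
  have hM' (q) (hq : q ∈ closure U) : q.1 ^ 2 ≤ M := hM (mem_image_of_mem _ hq)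
  have key (δ : ℝ) (hδ : 0 < δ) : s * ψ p.1 p.2 + b * p.2 ≤ c + δ * M := by
    obtain ⟨q, hq, hmax⟩ := hUc.exists_isMaxOn ⟨p, hp⟩
      (f := fun q : ℝ × ℝ => s * ψ q.1 q.2 + (δ * q.1 ^ 2 + b * q.2)) (by fun_prop)
    have hpq : s * ψ p.1 p.2 + (δ * p.1 ^ 2 + b * p.2) ≤
        s * ψ q.1 q.2 + (δ * q.1 ^ 2 + b * q.2) := hmax hp
    by_cases hqU : q ∈ U
    · exfalso
      have hloc : IsLocalMax (fun q : ℝ × ℝ => s * ψ q.1 q.2 + (δ * q.1 ^ 2 + b * q.2)) q :=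
        (hmax.on_subset subset_closure).isLocalMax (hU.mem_nhds hqU)
      have hψ : ContDiffAt ℝ 2 (fun p : ℝ × ℝ => ψ p.1 p.2) (q.1, q.2) :=
        hreg.contDiffAt (hU.mem_nhds hqU)
      have hψx : ContDiffAt ℝ 2 (fun t => ψ t q.2) q.1 :=
        hψ.comp (f := fun t : ℝ => (t, q.2)) q.1 (by fun_prop)
      have hψz : ContDiffAt ℝ 2 (fun t => ψ q.1 t) q.2 :=
        hψ.comp (f := fun t : ℝ => (q.1, t)) q.2 (by fun_prop)
      have hx := IsLocalMax.deriv_deriv_nonpos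
        (f := fun t => s * ψ t q.2 + (δ * t ^ 2 + 0 * t + b * q.2)) (x := q.1)
        (by
          have : Tendsto (fun t : ℝ => (t, q.2)) (𝓝 q.1) (𝓝 q) :=
            ContinuousAt.tendsto (f := fun t : ℝ => (t, q.2)) (by fun_prop)
          filter_upwards [this.eventually hloc] with t ht
          simpa using ht)
        (by have := hψx.continuousAt; fun_prop)
      have hz := IsLocalMax.deriv_deriv_nonpos
        (f := fun t => s * ψ q.1 t + (0 * t ^ 2 + b * t + δ * q.1 ^ 2)) (x := q.2)
        (by
          have : Tendsto (fun t : ℝ => (q.1, t)) (𝓝 q.2) (𝓝 q) :=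
            ContinuousAt.tendsto (f := fun t : ℝ => (q.1, t)) (by fun_prop)
          filter_upwards [this.eventually hloc] with t ht
          linarith)
        (by have := hψz.continuousAt; fun_prop)
      rw [deriv_deriv_const_mul_add_quadratic hψx] at hx
      rw [deriv_deriv_const_mul_add_quadratic hψz] at hz
      change s * pdxx ψ q.1 q.2 + 2 * δ ≤ 0 at hx
      change s * pdzz ψ q.1 q.2 + 2 * 0 ≤ 0 at hz
      have hε2 : 0 < ε ^ 2 := by positivity
      have h₁ := mul_nonpos_of_nonneg_of_nonpos hε2.le hx
      have h₂ : s * (ε ^ 2 * pdxx ψ q.1 q.2 + pdzz ψ q.1 q.2) = 0 := by rw [hpde q hqU, mul_zero]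
      have h₃ := mul_pos hε2 hδ
      linarith
    · have h₁ := hbc q (hU.frontier_eq ▸ ⟨hq, hqU⟩)
      have h₂ := mul_le_mul_of_nonneg_left (hM' q hq) hδ.le
      have h₃ : 0 ≤ δ * p.1 ^ 2 := by positivity
      linarith
  have hM0 : 0 ≤ M := (sq_nonneg _).trans (hM' p hp)
  refine le_of_forall_pos_le_add fun η hη => (key (η / (M + 1)) (by positivity)).trans ?_
  gcongr
  rw [div_mul_eq_mul_div, div_le_iff₀ (by positivity)]
  nlinarith

/-- If `ψ` is an electrostatic potential for `u` (with parameter `ε > 0`),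
then `1 + z ≤ ψ(x,z) ≤ 1` for every `(x,z)` in the closure of `Ω(u)`. -/
theorem potential_bounds (ε : ℝ) (hε : 0 < ε) (u : ℝ → ℝ) (ψ : ℝ → ℝ → ℝ)
    (hu_cont : ContinuousOn u (Icc (-1) 1))
    (hu_m1 : u (-1) = 0) (hu_p1 : u 1 = 0)
    (hu_rng : ∀ x ∈ Ioo (-1 : ℝ) 1, -1 < u x ∧ u x ≤ 0)
    (hψ_cont : ContinuousOn (fun p : ℝ × ℝ => ψ p.1 p.2) (closure (Omega u)))
    (hψ_reg : ContDiffOn ℝ 2 (fun p : ℝ × ℝ => ψ p.1 p.2) (Omega u))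
    (hψ_pde : ∀ p ∈ Omega u, ε ^ 2 * pdxx ψ p.1 p.2 + pdzz ψ p.1 p.2 = 0)
    (hψ_bc : ∀ p ∈ frontier (Omega u), ψ p.1 p.2 = (1 + p.2) / (1 + u p.1)) :
    ∀ p ∈ closure (Omega u), 1 + p.2 ≤ ψ p.1 p.2 ∧ ψ p.1 p.2 ≤ 1 := by
  have hsub := closure_Omega_subset hu_cont
  have hrng (x : ℝ) (hx : x ∈ Icc (-1 : ℝ) 1) : -1 < u x ∧ u x ≤ 0 := by
    rcases eq_endpoints_or_mem_Ioo_of_mem_Icc hx with rfl | rfl | h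
    · simp [hu_m1]
    · simp [hu_p1]
    · exact hu_rng x h
  have hcpt : IsCompact (closure (Omega u)) := by
    refine (isCompact_Icc (a := ((-1, -1) : ℝ × ℝ)) (b := (1, 0))).of_isClosed_subset
      isClosed_closure fun p hp => ?_
    obtain ⟨hx, hz, hzu⟩ := hsub hp
    exact ⟨⟨hx.1, hz⟩, hx.2, hzu.trans (hrng _ hx).2⟩
  have hfr (p) (hp : p ∈ frontier (Omega u)) : 1 + p.2 ≤ ψ p.1 p.2 ∧ ψ p.1 p.2 ≤ 1 := by
    obtain ⟨hx, hz, hzu⟩ := hsub (frontier_subset_closure hp)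
    obtain ⟨h₁, h₂⟩ := hrng _ hx
    rw [hψ_bc p hp, le_div_iff₀ (by linarith), div_le_one (by linarith)]
    constructor <;> nlinarith
  have hmax {s b c : ℝ} := rescaled_laplace_le_of_frontier_le (s := s) (b := b) (c := c) hε
    (isOpen_Omega hu_cont) hcpt hψ_cont hψ_reg hψ_pde
  intro p hp
  constructor
  · have := hmax (s := -1) (b := 1) (c := -1) (fun q hq => by linarith [(hfr q hq).1]) hp
    linarith
  · have := hmax (s := 1) (b := 0) (c := 1) (fun q hq => by linarith [(hfr q hq).2]) hp
    linarith
end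

section
/- Suppose ψ is an electrostatic potential for u (with parameter ε > 0) and suppose the partial derivative ∂ₓψ exists at the lateral boundary points (±1, z) for z ∈ (-1,0). Then ∂ₓψ(1,z) ≤ 0 and ∂ₓψ(-1,z) ≥ 0 for every z ∈ (-1,0). -/
open MeasureTheory Set

theorem IsLocalMin.deriv_deriv_nonneg {f : ℝ → ℝ} {a : ℝ} (h : IsLocalMin f a)
    (hf : ContinuousAt f a) : 0 ≤ deriv (deriv f) a := by
  by_contra! hneg
  have hmax : IsLocalMax f a := isLocalMax_of_deriv_deriv_neg hneg h.deriv_eq_zero hf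
  have hconst : f =ᶠ[nhds a] fun _ => f a := by
    filter_upwards [h, hmax] with x h₁ h₂ using le_antisymm h₂ h₁
  have := hconst.deriv.deriv_eq
  simp [this] at hneg

theorem deriv_deriv_sub_quadratic {f : ℝ → ℝ} {a : ℝ} (hf : ContDiffAt ℝ 2 f a) (δ : ℝ) :
    deriv (deriv fun t => f t - ((1 + t) + δ * (1 + t) ^ 2)) a = deriv (deriv f) a - 2 * δ := by
  have hq (t : ℝ) : HasDerivAt (fun t => (1 + t) + δ * (1 + t) ^ 2) (1 + 2 * δ * (1 + t)) t := by
    have h₁ : HasDerivAt (fun t : ℝ => 1 + t) 1 t := (hasDerivAt_id t).const_add 1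
    exact (h₁.fun_add ((h₁.fun_pow 2).const_mul δ)).congr_deriv (by norm_num; ring)
  have hd : deriv (fun t => f t - ((1 + t) + δ * (1 + t) ^ 2)) =ᶠ[nhds a]
      fun t => deriv f t - (1 + 2 * δ * (1 + t)) := by
    filter_upwards [hf.eventually (by simp)] with t ht
    exact ((ht.differentiableAt (by simp)).hasDerivAt.sub (hq t)).deriv
  have hdd : DifferentiableAt ℝ (deriv f) a :=
    (hf.derivWithin (m := 1) one_add_one_eq_two.le).differentiableAt (by simp)
  rw [hd.deriv_eq]
  have h₁ : HasDerivAt (fun t : ℝ => 1 + 2 * δ * (1 + t)) (2 * δ * 1) a :=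
    (((hasDerivAt_id a).const_add 1).const_mul (2 * δ)).const_add 1
  simpa using (hdd.hasDerivAt.fun_sub h₁).deriv

theorem closure_Omega_subset_s1 {u : ℝ → ℝ} (hu : ∀ x ∈ Ioo (-1 : ℝ) 1, u x ≤ 0) :
    closure (Omega u) ⊆ Icc (-1) 1 ×ˢ Icc (-1) 0 := by
  refine closure_minimal ?_ (isClosed_Icc.prod isClosed_Icc)
  rintro p ⟨h₁, h₂, h₃, h₄⟩
  exact ⟨⟨h₁.le, h₂.le⟩, h₃.le, h₄.le.trans (hu _ ⟨h₁, h₂⟩)⟩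

/-- Comparison principle: a potential whose boundary values dominate `1 + z` dominates it on the
whole region. -/
theorem one_add_le_of_frontier {ε : ℝ} {u : ℝ → ℝ} {ψ : ℝ → ℝ → ℝ}
    (hu : ∀ x ∈ Ioo (-1 : ℝ) 1, u x ≤ 0)
    (hψ_cont : ContinuousOn (fun p : ℝ × ℝ => ψ p.1 p.2) (closure (Omega u)))
    (hψ_reg : ContDiffOn ℝ 2 (fun p : ℝ × ℝ => ψ p.1 p.2) (Omega u))
    (hψ_pde : ∀ p ∈ Omega u, ε ^ 2 * pdxx ψ p.1 p.2 + pdzz ψ p.1 p.2 = 0)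
    (hbd : ∀ p ∈ frontier (Omega u), 1 + p.2 ≤ ψ p.1 p.2)
    {p : ℝ × ℝ} (hp : p ∈ closure (Omega u)) : 1 + p.2 ≤ ψ p.1 p.2 := by
  refine le_of_forall_pos_le_add fun δ hδ => ?_
  have hsub := closure_Omega_subset_s1 hu
  have hcomp : IsCompact (closure (Omega u)) :=
    (isCompact_Icc.prod isCompact_Icc).of_isClosed_subset isClosed_closure hsub
  obtain ⟨q, hq, hmin⟩ := hcomp.exists_isMinOn
    (f := fun p : ℝ × ℝ => ψ p.1 p.2 - ((1 + p.2) + δ * (1 + p.2) ^ 2)) ⟨p, hp⟩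
    (hψ_cont.sub (by fun_prop))
  have hle := isMinOn_iff.1 hmin p hp
  by_cases hqf : q ∈ frontier (Omega u)
  · have h₁ := hbd q hqf
    obtain ⟨-, h₂, h₃⟩ := hsub hq
    have h₄ : (1 + q.2) ^ 2 ≤ 1 := by nlinarith
    nlinarith [mul_nonneg hδ.le (sq_nonneg (1 + p.2)), mul_le_mul_of_nonneg_left h₄ hδ.le]
  · have hqi : q ∈ interior (Omega u) := by
      rw [closure_eq_interior_union_frontier] at hq
      exact hq.resolve_right hqf
    have hnhds : Omega u ∈ nhds q := mem_interior_iff_mem_nhds.1 hqi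
    have hloc : IsLocalMin
        (fun p : ℝ × ℝ => ψ p.1 p.2 - ((1 + p.2) + δ * (1 + p.2) ^ 2)) q :=
      hmin.isLocalMin (Filter.mem_of_superset hnhds subset_closure)
    have hC : ContDiffAt ℝ 2 (fun p : ℝ × ℝ => ψ p.1 p.2) q := hψ_reg.contDiffAt hnhds
    have hCx : ContDiffAt ℝ 2 (fun x => ψ x q.2) q.1 :=
      ContDiffAt.comp (g := fun p : ℝ × ℝ => ψ p.1 p.2) (f := fun x => (x, q.2)) q.1 hC
        (by fun_prop)
    have hCz : ContDiffAt ℝ 2 (fun z => ψ q.1 z) q.2 :=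
      ContDiffAt.comp (g := fun p : ℝ × ℝ => ψ p.1 p.2) (f := fun z => (q.1, z)) q.2 hC
        (by fun_prop)
    have hx : IsLocalMin (fun x => ψ x q.2) q.1 := by
      have ht : Filter.Tendsto (fun x : ℝ => (x, q.2)) (nhds q.1) (nhds q) :=
        (by fun_prop : Continuous fun x : ℝ => (x, q.2)).tendsto q.1
      filter_upwards [ht.eventually hloc] with x h
      simpa using h
    have hz : IsLocalMin (fun z => ψ q.1 z - ((1 + z) + δ * (1 + z) ^ 2)) q.2 := by
      have ht : Filter.Tendsto (fun z : ℝ => (q.1, z)) (nhds q.2) (nhds q) :=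
        (by fun_prop : Continuous fun z : ℝ => (q.1, z)).tendsto q.2
      exact ht.eventually hloc
    have hxx : 0 ≤ pdxx ψ q.1 q.2 := hx.deriv_deriv_nonneg hCx.continuousAt
    have hzz := hz.deriv_deriv_nonneg (hCz.continuousAt.sub (by fun_prop))
    rw [deriv_deriv_sub_quadratic hCz] at hzz
    have hzz' : 0 ≤ pdzz ψ q.1 q.2 - 2 * δ := hzz
    have hpde := hψ_pde q (interior_subset hqi)
    nlinarith [mul_nonneg (sq_nonneg ε) hxx]

/-- If `ψ` is an electrostatic potential for `u` (with parameter `ε > 0`) and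
`∂ₓψ` exists at the lateral boundary points `(±1, z)` for `z ∈ (-1,0)`, then
`∂ₓψ(1,z) ≤ 0` and `∂ₓψ(-1,z) ≥ 0` for every `z ∈ (-1,0)`. -/
theorem lateral_sign (ε : ℝ) (hε : 0 < ε) (u : ℝ → ℝ) (ψ : ℝ → ℝ → ℝ)
    (hu_cont : ContinuousOn u (Icc (-1) 1))
    (hu_m1 : u (-1) = 0) (hu_p1 : u 1 = 0)
    (hu_rng : ∀ x ∈ Ioo (-1 : ℝ) 1, -1 < u x ∧ u x ≤ 0)
    (hψ_cont : ContinuousOn (fun p : ℝ × ℝ => ψ p.1 p.2) (closure (Omega u)))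
    (hψ_reg : ContDiffOn ℝ 2 (fun p : ℝ × ℝ => ψ p.1 p.2) (Omega u))
    (hψ_pde : ∀ p ∈ Omega u, ε ^ 2 * pdxx ψ p.1 p.2 + pdzz ψ p.1 p.2 = 0)
    (hψ_bc : ∀ p ∈ frontier (Omega u), ψ p.1 p.2 = (1 + p.2) / (1 + u p.1))
    (hψ_dx : ∀ z ∈ Ioo (-1 : ℝ) 0,
      DifferentiableAt ℝ (fun x' => ψ x' z) 1 ∧ DifferentiableAt ℝ (fun x' => ψ x' z) (-1)) :
    ∀ z ∈ Ioo (-1 : ℝ) 0, pdx ψ 1 z ≤ 0 ∧ 0 ≤ pdx ψ (-1) z := by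
  intro z hz
  have hu : ∀ x ∈ Ioo (-1 : ℝ) 1, u x ≤ 0 := fun x hx => (hu_rng x hx).2
  have hbd : ∀ p ∈ frontier (Omega u), 1 + p.2 ≤ ψ p.1 p.2 := by
    intro p hp
    obtain ⟨⟨h₁, h₂⟩, h₃, -⟩ := closure_Omega_subset_s1 hu (frontier_subset_closure hp)
    have hup : -1 < u p.1 ∧ u p.1 ≤ 0 := by
      rcases h₁.eq_or_lt with h | h
      · simp [← h, hu_m1]
      rcases h₂.eq_or_lt with h' | h'
      · simp [h', hu_p1]
      exact hu_rng _ ⟨h, h'⟩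
    rw [hψ_bc p hp, le_div_iff₀ (by linarith)]
    nlinarith
  have hge := fun {p : ℝ × ℝ} (hp : p ∈ closure (Omega u)) =>
    one_add_le_of_frontier hu hψ_cont hψ_reg hψ_pde hbd hp
  have hlat (s : ℝ) (hs : s ∈ Icc (-1 : ℝ) 1) (hs' : s ∉ Ioo (-1 : ℝ) 1) (hus : u s = 0)
      [(nhdsWithin s (Ioo (-1) 1)).NeBot] :
      ∀ᶠ x in nhdsWithin s (Ioo (-1) 1), ψ s z ≤ ψ x z := by
    have hev : ∀ᶠ x in nhdsWithin s (Ioo (-1) 1), (x, z) ∈ Omega u := by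
      have ht := (hu_cont s hs).mono Ioo_subset_Icc_self
      filter_upwards [ht.eventually_const_lt (hus ▸ hz.2), self_mem_nhdsWithin] with x h hx
      exact ⟨hx.1, hx.2, hz.1, h⟩
    have hcl : (s, z) ∈ closure (Omega u) := by
      refine mem_closure_of_tendsto (f := fun x : ℝ => (x, z)) (b := nhdsWithin s (Ioo (-1) 1))
        ?_ hev
      exact ((by fun_prop : Continuous fun x : ℝ => (x, z)).tendsto s).mono_left
        nhdsWithin_le_nhds
    have hfr : (s, z) ∈ frontier (Omega u) :=
      ⟨hcl, fun h => hs' ⟨(interior_subset h).1, (interior_subset h).2.1⟩⟩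
    have hval : ψ s z = 1 + z := by simpa [hus] using hψ_bc _ hfr
    filter_upwards [hev] with x hx
    exact hval ▸ hge (subset_closure hx)
  constructor
  · have hnhds : nhdsWithin (1 : ℝ) (Ioo (-1) 1) = nhdsWithin 1 (Iio 1) :=
      nhdsWithin_Ioo_eq_nhdsLT (by norm_num)
    have : (nhdsWithin (1 : ℝ) (Ioo (-1) 1)).NeBot := hnhds ▸ inferInstance
    have hle := hnhds ▸ hlat 1 (by norm_num) (by simp) hu_p1
    refine le_of_tendsto
      (((hψ_dx z hz).1.hasDerivAt.tendsto_slope).mono_left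
        (nhdsWithin_mono (s := Iio 1) 1 fun x (hx : x < 1) => hx.ne)) ?_
    filter_upwards [hle, self_mem_nhdsWithin] with x h hx
    rw [slope_def_field]
    exact div_nonpos_of_nonneg_of_nonpos (sub_nonneg.2 h) (sub_nonpos.2 (mem_Iio.1 hx).le)
  · have hnhds : nhdsWithin (-1 : ℝ) (Ioo (-1) 1) = nhdsWithin (-1) (Ioi (-1)) :=
      nhdsWithin_Ioo_eq_nhdsGT (by norm_num)
    have : (nhdsWithin (-1 : ℝ) (Ioo (-1) 1)).NeBot := hnhds ▸ inferInstance
    have hle := hnhds ▸ hlat (-1) (by norm_num) (by simp) hu_m1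
    refine ge_of_tendsto
      (((hψ_dx z hz).2.hasDerivAt.tendsto_slope).mono_left
        (nhdsWithin_mono (s := Ioi (-1)) (-1) fun x (hx : -1 < x) => hx.ne')) ?_
    filter_upwards [hle, self_mem_nhdsWithin] with x h hx
    rw [slope_def_field]
    exact div_nonneg (sub_nonneg.2 h) (sub_nonneg.2 (mem_Ioi.1 hx).le)
end

section
/- Let ε > 0, λ > 1/ε, T ∈ (0,∞], and let E : [0,T) → ℝ be differentiable with 0 ≤ E(t) < 1 for all t ∈ [0,T) and E'(t) ≥ F_λ(E(t)) for all t ∈ (0,T), where F_λ(r) := 2λ/(1−r) − λ − 1/ε for r < 1. Then T is finite and moreover T ≤ (1 − E(0))/(λ − 1/ε). -/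
open Set

/-- If `ε > 0`, `λ > 1/ε`, and `E : [0,T) → ℝ` is differentiable with
`0 ≤ E(t) < 1` on `[0,T)` and `E'(t) ≥ F_λ(E(t)) := 2λ/(1-E(t)) - λ - 1/ε` on `(0,T)`,
then `T` is finite and `T ≤ (1 - E(0))/(λ - 1/ε)`. -/
theorem finite_time_ode (ε lam : ℝ) (hε : 0 < ε) (hlam : 1 / ε < lam)
    (T : EReal) (hT : 0 < T) (E : ℝ → ℝ)
    (hdiff : ∀ t : ℝ, 0 ≤ t → (t : EReal) < T → DifferentiableAt ℝ E t)
    (hrng : ∀ t : ℝ, 0 ≤ t → (t : EReal) < T → 0 ≤ E t ∧ E t < 1)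
    (hineq : ∀ t : ℝ, 0 < t → (t : EReal) < T →
      2 * lam / (1 - E t) - lam - 1 / ε ≤ deriv E t) :
    T ≠ ⊤ ∧ T ≤ (((1 - E 0) / (lam - 1 / ε) : ℝ) : EReal) := by
  have hc : 0 < lam - 1 / ε := sub_pos.2 hlam
  have hlam0 : 0 < lam := (one_div_pos.2 hε).trans hlam
  have hle : T ≤ (((1 - E 0) / (lam - 1 / ε) : ℝ) : EReal) := by
    by_contra! hb
    set b : ℝ := (1 - E 0) / (lam - 1 / ε) with hb_def
    have hb0 : 0 < b := div_pos (sub_pos.2 (hrng 0 le_rfl hT).2) hc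
    have hlt : ∀ t ≤ b, (t : EReal) < T := fun t ht =>
      (EReal.coe_le_coe_iff.2 ht).trans_lt hb
    obtain ⟨s, hs, hderiv⟩ := exists_deriv_eq_slope E hb0
      (fun t ht => (hdiff t ht.1 (hlt t ht.2)).continuousAt.continuousWithinAt)
      (fun t ht => (hdiff t ht.1.le (hlt t ht.2.le)).differentiableWithinAt)
    have hEs := hrng s hs.1.le (hlt s hs.2.le)
    have hF : 2 * lam ≤ 2 * lam / (1 - E s) :=
      le_div_self (by positivity) (sub_pos.2 hEs.2) (by linarith)
    have hslope : lam - 1 / ε ≤ (E b - E 0) / (b - 0) := by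
      have := hineq s hs.1 (hlt s hs.2.le)
      linarith
    rw [sub_zero, le_div_iff₀ hb0, hb_def, mul_div_cancel₀ _ hc.ne', ← hb_def] at hslope
    have := (hrng b hb0.le hb).2
    linarith
  exact ⟨(hle.trans_lt (EReal.coe_lt_top _)).ne, hle⟩
end
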